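/- arXiv:2603.07470 — 3 statements merged into one kernel-verified Lean document; each statement's English description precedes it below -/
import Mathlib

section
/- Let 0 < r₁ < r < 1 be real numbers, let B_ρ denote the closed disk of radius ρ centered at the origin in ℝ², and fix a point x₀ on the boundary circle ∂B_r. Let g : B_r × [0,1] → B_r × [0,1] be a homeomorphism such that g({0} × [0,1]) = {0} × [0,1], g((∂B_r) × [0,1]) = (∂B_r) × [0,1], and g(B_r × {0}) = B_r × {0}. Then there exists a homeomorphism h : B₁ × [0,1] → B₁ × [0,1] with the following properties: (1) h restricted to B_{r₁} × [0,1] is the identity; (2) h(B_r × [0,1]) = B_r × [0,1]; (3) h(g({x₀} × [0,1])) = {x₀} × [0,1]; (4) h restricted to (∂B₁) × [0,1] is the identity. -/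
open Metric Set

/-- The Euclidean plane. -/
abbrev E2 : Type := EuclideanSpace ℝ (Fin 2)

/-- `f` induces a homeomorphism from the subspace `A` onto the subspace `B`. -/
def IsHomeoOn {X Y : Type*} [TopologicalSpace X] [TopologicalSpace Y]
    (f : X → Y) (A : Set X) (B : Set Y) : Prop :=
  ∃ e : A ≃ₜ B, ∀ a : A, (e a : Y) = f a

section Straightening

open unitInterval Filter Topology

/-- The spike transform of a self-map `j` of the annulus `Circle × I` with angular displacement
`ε`: on the spike `1 - t ≤ |x|` it is the lift of `j` to the strip, written in logarithmic
coordinates and squeezed towards the tip `x = 0`, `t = 1`; elsewhere it is the identity as soon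
as `j` is the identity on the bottom circle. -/
noncomputable def spike (j : Circle × I → Circle × I) (ε : Circle × I → ℝ)
    (q : Circle × I × ℝ) : Circle × I × ℝ :=
  let m := min |q.2.2| 1
  let a := (q.1 * Circle.exp (Real.log q.2.2),
    Set.projIcc (0 : ℝ) 1 zero_le_one (1 - (1 - q.2.1) / m))
  let x := q.2.2 * Real.exp (ε a)
  (q.1, Set.projIcc (0 : ℝ) 1 zero_le_one
    (1 - (1 - (j a).2) * min |x| 1 - max (1 - q.2.1 - m) 0), x)

section Spike

variable {j k : Circle × I → Circle × I} {ε d : Circle × I → ℝ}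

lemma spike_of_ge (hj : ∀ z, j (z, 0) = (z, 0)) (hε : ∀ z, ε (z, 0) = 0)
    {w : Circle} {t : I} {x : ℝ} (h : min |x| 1 ≤ 1 - t) :
    spike j ε (w, t, x) = (w, t, x) := by
  have ht := t.2.1
  rcases eq_or_ne x 0 with rfl | hx
  · have : Set.projIcc (0 : ℝ) 1 zero_le_one (t : ℝ) = t := Set.projIcc_val _ t
    have h' := t.2.2
    simp [spike, h', this]
  · have hm : 0 < min |x| 1 := lt_min (abs_pos.2 hx) one_pos
    have hv : Set.projIcc (0 : ℝ) 1 zero_le_one (1 - (1 - t) / min |x| 1) = 0 := by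
      apply Set.projIcc_of_le_left
      rw [sub_nonpos, le_div_iff₀ hm]; linarith
    have : Set.projIcc (0 : ℝ) 1 zero_le_one (t : ℝ) = t := Set.projIcc_val _ t
    simp only [spike, hv, hj, hε, Real.exp_zero, mul_one]
    rw [max_eq_left (by linarith)]
    simp [this]

lemma spike_of_le {w : Circle} {t : I} {x : ℝ} (hx : x ≠ 0) (h : 1 - t ≤ min |x| 1) (v : I)
    (hv : (1 - v) * min |x| 1 = 1 - t) :
    spike j ε (w, t, x) = (w, Set.projIcc (0 : ℝ) 1 zero_le_one
      (1 - (1 - (j (w * Circle.exp (Real.log x), v)).2) *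
        min |x * Real.exp (ε (w * Circle.exp (Real.log x), v))| 1),
      x * Real.exp (ε (w * Circle.exp (Real.log x), v))) := by
  have hm : 0 < min |x| 1 := lt_min (abs_pos.2 hx) one_pos
  have hv' : 1 - (1 - (t : ℝ)) / min |x| 1 = v := by
    rw [← hv]; field_simp; ring
  have : Set.projIcc (0 : ℝ) 1 zero_le_one (v : ℝ) = v := Set.projIcc_val _ v
  simp only [spike, hv', this]
  rw [max_eq_right (by linarith), sub_zero]

lemma spike_of_one_le {w : Circle} {t : I} {x : ℝ}
    (hx : 1 ≤ |x|) (hx' : 1 ≤ |x * Real.exp (ε (w * Circle.exp (Real.log x), t))|) :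
    spike j ε (w, t, x) = (w, (j (w * Circle.exp (Real.log x), t)).2,
      x * Real.exp (ε (w * Circle.exp (Real.log x), t))) := by
  have hx0 : x ≠ 0 := by rintro rfl; norm_num at hx
  rw [spike_of_le hx0 (by rw [min_eq_right hx]; linarith [t.2.1]) t (by rw [min_eq_right hx, mul_one]),
    min_eq_right hx']
  simp

lemma spike_spike (hj0 : ∀ z, j (z, 0) = (z, 0)) (hε0 : ∀ z, ε (z, 0) = 0)
    (hk0 : ∀ z, k (z, 0) = (z, 0)) (hd0 : ∀ z, d (z, 0) = 0)
    (hj : ∀ p, (j p).1 = p.1 * Circle.exp (ε p)) (hkj : ∀ p, k (j p) = p)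
    (hd : ∀ p, d (j p) = - ε p) (q : Circle × I × ℝ) : spike k d (spike j ε q) = q := by
  obtain ⟨w, t, x⟩ := q
  rcases le_total (min |x| 1) (1 - t) with h | h
  · rw [spike_of_ge hj0 hε0 h, spike_of_ge hk0 hd0 h]
  rcases eq_or_ne x 0 with rfl | hx
  · have h' : min |(0 : ℝ)| 1 ≤ 1 - t := by simpa using t.2.2
    rw [spike_of_ge hj0 hε0 h', spike_of_ge hk0 hd0 h']
  have hm : 0 < min |x| 1 := lt_min (abs_pos.2 hx) one_pos
  have ht1 : (0 : ℝ) ≤ 1 - t := sub_nonneg.2 t.2.2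
  obtain ⟨v, hv⟩ : ∃ v : I, (1 - (v : ℝ)) * min |x| 1 = 1 - t := by
    refine ⟨⟨1 - (1 - t) / min |x| 1, ?_, ?_⟩, ?_⟩
    · rw [sub_nonneg, div_le_one hm]; exact h
    · have := div_nonneg ht1 hm.le; linarith
    · simp only []; field_simp; ring
  rw [spike_of_le hx h v hv]
  set a := (w * Circle.exp (Real.log x), v) with ha
  set x' := x * Real.exp (ε a) with hx'
  have hx'0 : x' ≠ 0 := mul_ne_zero hx (Real.exp_pos _).ne'
  have hm' : 0 < min |x'| 1 := lt_min (abs_pos.2 hx'0) one_pos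
  have hm1 : min |x'| 1 ≤ 1 := min_le_right _ _
  have hs0 := (j a).2.2.1
  have hs1 := (j a).2.2.2
  have hmem : 1 - (1 - ((j a).2 : ℝ)) * min |x'| 1 ∈ Set.Icc (0 : ℝ) 1 := by
    constructor <;> nlinarith
  rw [Set.projIcc_of_mem _ hmem]
  have hlog : Real.log x' = Real.log x + ε a := by
    rw [hx', Real.log_mul hx (Real.exp_pos _).ne', Real.log_exp]
  have ha' : (w * Circle.exp (Real.log x'), (j a).2) = j a := by
    refine Prod.ext ?_ rfl
    rw [hj, hlog, Circle.exp_add, ← mul_assoc]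
  rw [spike_of_le hx'0 (by simp only []; nlinarith) (j a).2 (by simp), ha', hkj, hd]
  have hxx : x' * Real.exp (-ε a) = x := by
    rw [hx', mul_assoc, ← Real.exp_add, add_neg_cancel, Real.exp_zero, mul_one]
  rw [hxx, hv]
  simp

lemma continuous_spike (hjc : Continuous j) (hεc : Continuous ε) : Continuous (spike j ε) := by
  obtain ⟨D, hD⟩ : ∃ D, ∀ p, ε p ≤ D := by
    obtain ⟨D, hD⟩ := (isCompact_range hεc).bddAbove
    exact ⟨D, fun p => hD ⟨p, rfl⟩⟩
  rw [continuous_iff_continuousAt]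
  rintro ⟨w, t, x⟩
  rcases eq_or_ne x 0 with rfl | hx
  · have hX : Tendsto (fun q : Circle × I × ℝ => (spike j ε q).2.2) (𝓝 (w, t, 0)) (𝓝 0) := by
      have hc : Tendsto (fun q : Circle × I × ℝ => |q.2.2| * Real.exp D) (𝓝 (w, t, 0)) (𝓝 0) := by
        have : Continuous (fun q : Circle × I × ℝ => |q.2.2| * Real.exp D) := by fun_prop
        simpa using this.tendsto (w, t, 0)
      refine squeeze_zero_norm (fun q => ?_) hc
      simp only [spike, Real.norm_eq_abs, abs_mul, Real.abs_exp]
      gcongr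
      exact hD _
    have hδ : Tendsto (fun q : Circle × I × ℝ => (1 - ((j (q.1 * Circle.exp (Real.log q.2.2),
        Set.projIcc (0 : ℝ) 1 zero_le_one (1 - (1 - q.2.1) / min |q.2.2| 1))).2 : ℝ)) *
        min |(spike j ε q).2.2| 1) (𝓝 (w, t, 0)) (𝓝 0) := by
      have hc : Tendsto (fun q : Circle × I × ℝ => |(spike j ε q).2.2|) (𝓝 (w, t, 0)) (𝓝 0) := by
        simpa using hX.abs
      refine squeeze_zero (fun q => ?_) (fun q => ?_) hc
      · exact mul_nonneg (sub_nonneg.2 (j _).2.2.2) (le_min (abs_nonneg _) zero_le_one)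
      · calc _ ≤ 1 * |(spike j ε q).2.2| := by
              gcongr
              · linarith [(j (q.1 * Circle.exp (Real.log q.2.2), Set.projIcc (0 : ℝ) 1 zero_le_one
                  (1 - (1 - q.2.1) / min |q.2.2| 1))).2.2.1]
              · exact min_le_left _ _
          _ = _ := one_mul _
    have hM : Tendsto (fun q : Circle × I × ℝ => max (1 - (q.2.1 : ℝ) - min |q.2.2| 1) 0)
        (𝓝 (w, t, 0)) (𝓝 (1 - t)) := by
      have : Continuous (fun q : Circle × I × ℝ => max (1 - (q.2.1 : ℝ) - min |q.2.2| 1) 0) := by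
        fun_prop
      have h2 := this.tendsto (w, t, 0)
      simpa [max_eq_left (sub_nonneg.2 t.2.2)] using h2
    have hT := ((continuous_projIcc (h := zero_le_one' ℝ)).tendsto _).comp
      ((tendsto_const_nhds (x := (1 : ℝ))).sub hδ |>.sub hM)
    have h0 : spike j ε (w, t, 0) = (w, t, 0) := by
      have : Set.projIcc (0 : ℝ) 1 zero_le_one (t : ℝ) = t := Set.projIcc_val _ t
      simp [spike, max_eq_left (sub_nonneg.2 t.2.2), this]
    rw [ContinuousAt, h0]
    have hp : Set.projIcc (0 : ℝ) 1 zero_le_one ((1 : ℝ) - 0 - (1 - t)) = t := by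
      rw [show (1 : ℝ) - 0 - (1 - t) = t by ring]; exact Set.projIcc_val _ t
    rw [hp] at hT
    exact continuous_fst.continuousAt.tendsto.prodMk_nhds (hT.prodMk_nhds hX)
  · have hm : min |x| 1 ≠ 0 := (lt_min (abs_pos.2 hx) one_pos).ne'
    have ha : ContinuousAt (fun q : Circle × I × ℝ => (q.1 * Circle.exp (Real.log q.2.2),
        Set.projIcc (0 : ℝ) 1 zero_le_one (1 - (1 - q.2.1) / min |q.2.2| 1))) (w, t, x) := by
      refine ContinuousAt.prodMk ?_ ?_
      · refine continuousAt_fst.mul (Circle.exp.continuous.continuousAt.comp ?_)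
        exact (by fun_prop : ContinuousAt (fun q : Circle × I × ℝ => q.2.2) (w, t, x)).log hx
      · refine (continuous_projIcc (h := zero_le_one' ℝ)).continuousAt.comp ?_
        refine continuousAt_const.sub (ContinuousAt.div ?_ ?_ hm) <;> fun_prop
    have key : ∀ a : Circle × I × ℝ → Circle × I, ContinuousAt a (w, t, x) →
        ContinuousAt (fun q : Circle × I × ℝ => (q.1, Set.projIcc (0 : ℝ) 1 zero_le_one
          (1 - (1 - (j (a q)).2) * min |q.2.2 * Real.exp (ε (a q))| 1 -
            max (1 - (q.2.1 : ℝ) - min |q.2.2| 1) 0), q.2.2 * Real.exp (ε (a q)))) (w, t, x) := by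
      intro a ha
      have hp := continuous_projIcc (h := zero_le_one' ℝ)
      fun_prop
    exact key _ ha

end Spike

/-- The spike transform as a homeomorphism of `Circle × I × ℝ`. -/
noncomputable def spikeHomeo (k : Circle × I ≃ₜ Circle × I) (d : Circle × I → ℝ)
    (hd : Continuous d) (hk0 : ∀ z, k (z, 0) = (z, 0)) (hd0 : ∀ z, d (z, 0) = 0)
    (hk : ∀ p, (k p).1 = p.1 * Circle.exp (d p)) : Circle × I × ℝ ≃ₜ Circle × I × ℝ :=
  have hs0 : ∀ z, k.symm (z, 0) = (z, 0) := fun z => by rw [Homeomorph.symm_apply_eq, hk0]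
  have hε0 : ∀ z, -d (k.symm (z, 0)) = 0 := fun z => by rw [hs0, hd0, neg_zero]
  { toFun := spike k d
    invFun := spike k.symm fun p => -d (k.symm p)
    left_inv := spike_spike hk0 hd0 hs0 hε0 hk (by simp) (by simp)
    right_inv := spike_spike hs0 hε0 hk0 hd0
      (fun p => by
        have := hk (k.symm p)
        rw [k.apply_symm_apply] at this
        rw [this, mul_assoc, ← Circle.exp_add, add_neg_cancel, Circle.exp_zero, mul_one])
      (by simp) (by simp)
    continuous_toFun := continuous_spike k.continuous hd
    continuous_invFun := continuous_spike k.symm.continuous (hd.comp k.symm.continuous).neg }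

/-- Rotation of `Circle × I × ℝ` by an angle depending on the real coordinate. -/
noncomputable def shearHomeo (β : ℝ → ℝ) (hβ : Continuous β) :
    Circle × I × ℝ ≃ₜ Circle × I × ℝ where
  toFun q := (q.1 * Circle.exp (β q.2.2), q.2)
  invFun q := (q.1 * Circle.exp (-β q.2.2), q.2)
  left_inv q := by simp [mul_assoc]
  right_inv q := by simp [mul_assoc]
  continuous_toFun := by fun_prop
  continuous_invFun := by fun_prop

/-- Apply `k` to the annulus coordinates and rescale the real coordinate by `exp d`. -/
noncomputable def skewHomeo (k : Circle × I ≃ₜ Circle × I) (d : Circle × I → ℝ)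
    (hd : Continuous d) : Circle × I × ℝ ≃ₜ Circle × I × ℝ where
  toFun q := ((k (q.1, q.2.1)).1, (k (q.1, q.2.1)).2, q.2.2 * Real.exp (d (q.1, q.2.1)))
  invFun q := ((k.symm (q.1, q.2.1)).1, (k.symm (q.1, q.2.1)).2,
    q.2.2 * Real.exp (-d (k.symm (q.1, q.2.1))))
  left_inv q := by simp [mul_assoc, ← Real.exp_add]
  right_inv q := by simp [mul_assoc, ← Real.exp_add]
  continuous_toFun := by fun_prop
  continuous_invFun := by
    have := k.symm.continuous
    fun_prop

/-- Scaling of the real coordinate of `Circle × I × ℝ`. -/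
noncomputable def scaleHomeo (c : ℝ) (hc : c ≠ 0) : Circle × I × ℝ ≃ₜ Circle × I × ℝ :=
  (Homeomorph.refl _).prodCongr ((Homeomorph.refl _).prodCongr (Homeomorph.mulRight₀ c hc))

/-- A homeomorphism of the annulus fixing the bottom circle pointwise has a continuous angular
displacement vanishing on the bottom circle. -/
lemma exists_displacement (k : Circle × I ≃ₜ Circle × I) (hk0 : ∀ z, k (z, 0) = (z, 0)) :
    ∃ d : Circle × I → ℝ, Continuous d ∧ (∀ z, d (z, 0) = 0) ∧
      ∀ p, (k p).1 = p.1 * Circle.exp (d p) := by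
  let H : C(I × Circle, Circle) := ⟨fun p => (k (p.2, p.1)).1 * p.2⁻¹, by fun_prop⟩
  have H0 : ∀ z, H (0, z) = Circle.exp ((0 : C(Circle, ℝ)) z) := fun z => by simp [H, hk0]
  refine ⟨fun p => Circle.isCoveringMap_exp.liftHomotopy H 0 H0 (p.2, p.1), by fun_prop,
    fun z => Circle.isCoveringMap_exp.liftHomotopy_zero H 0 H0 z, fun p => ?_⟩
  have := congrFun (Circle.isCoveringMap_exp.liftHomotopy_lifts H 0 H0) (p.2, p.1)
  simp only [Function.comp_apply] at this
  rw [this]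
  simp [H]

/-- An annulus homeomorphism `k` fixing the bottom circle pointwise, followed by a rotation,
extends from the level `0` of `Circle × I × ℝ` to a homeomorphism which is the identity outside
the levels of absolute value less than one, and which preserves the signs of levels. -/
lemma exists_homeo_of_fix_bottom (k : Circle × I ≃ₜ Circle × I) (hk0 : ∀ z, k (z, 0) = (z, 0))
    (θ : ℝ) :
    ∃ Θ : Circle × I × ℝ ≃ₜ Circle × I × ℝ,
      (∀ q, 1 ≤ |q.2.2| → Θ q = q) ∧ (∀ q, (Θ q).2.2 ≤ 0 ↔ q.2.2 ≤ 0) ∧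
      ∀ z t, Θ (z, t, 0) = ((k (z, t)).1 * Circle.exp θ, (k (z, t)).2, 0) := by
  obtain ⟨d, hd, hd0, hk⟩ := exists_displacement k hk0
  obtain ⟨D, hD0, hD⟩ : ∃ D, 0 ≤ D ∧ ∀ p, |d p| ≤ D := by
    obtain ⟨D, hD⟩ := (isCompact_range hd.abs).bddAbove
    exact ⟨D, (abs_nonneg _).trans (hD ⟨(1, 0), rfl⟩), fun p => hD ⟨p, rfl⟩⟩
  set c := Real.exp D with hc
  have hc0 : 0 < c := Real.exp_pos _
  have hc1 : 1 ≤ c := Real.one_le_exp hD0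
  let β : ℝ → ℝ := fun x => Real.log (max |x| 1)
  have hβ : Continuous β := by
    refine Continuous.log (by fun_prop) fun x => ?_
    exact (lt_of_lt_of_le one_pos (le_max_right _ _)).ne'
  have hβ1 : ∀ x, 1 ≤ |x| → β x = Real.log x := fun x hx => by
    simp only [β]; rw [max_eq_left hx, Real.log_abs]
  let ψ : ℝ → ℝ := fun x => β x + θ * max 0 (1 - |x|)
  have hψ : Continuous ψ := by fun_prop
  have hψ1 : ∀ x, 1 ≤ |x| → ψ x = Real.log x := fun x hx => by
    simp only [ψ]; rw [max_eq_left (by linarith), mul_zero, add_zero, hβ1 x hx]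
  let S := (spikeHomeo k d hd hk0 hd0 hk).symm
  have hS : ∀ q, S q = spike k.symm (fun p => -d (k.symm p)) q := fun q => rfl
  let Θ := (scaleHomeo c hc0.ne').trans <| (skewHomeo k d hd).trans <|
    (shearHomeo (fun x => -β x) hβ.neg).trans <| S.trans <| (shearHomeo ψ hψ).trans
      (scaleHomeo c⁻¹ (inv_ne_zero hc0.ne'))
  have hs0 : ∀ z, k.symm (z, 0) = (z, 0) := fun z => by rw [Homeomorph.symm_apply_eq, hk0]
  have hε0 : ∀ z, -d (k.symm (z, 0)) = 0 := fun z => by rw [hs0, hd0, neg_zero]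
  have hΘ : ∀ q, Θ q =
      let x := q.2.2 * c * Real.exp (d (q.1, q.2.1))
      let y := S ((k (q.1, q.2.1)).1 * Circle.exp (-β x), (k (q.1, q.2.1)).2, x)
      (y.1 * Circle.exp (ψ y.2.2), y.2.1, y.2.2 * c⁻¹) := fun q => rfl
  refine ⟨Θ, ?_, ?_, ?_⟩
  · rintro ⟨z, t, x⟩ hx
    simp only at hx
    rw [hΘ]
    simp only
    set X := x * c * Real.exp (d (z, t)) with hX
    have hx0 : x ≠ 0 := by rintro rfl; norm_num at hx
    have hX1 : 1 ≤ |X| := by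
      rw [hX, mul_assoc, abs_mul, hc, ← Real.exp_add, Real.abs_exp]
      exact one_le_mul_of_one_le_of_one_le hx
        (Real.one_le_exp (by linarith [neg_abs_le (d (z, t)), hD (z, t)]))
    have hy : (k (z, t)).1 * Circle.exp (-β X) * Circle.exp (Real.log X) = (k (z, t)).1 := by
      rw [hβ1 X hX1, mul_assoc, ← Circle.exp_add, neg_add_cancel, Circle.exp_zero, mul_one]
    have hXx : X * Real.exp (-d (z, t)) = x * c := by
      rw [hX, mul_assoc, ← Real.exp_add, add_neg_cancel, Real.exp_zero, mul_one]
    have hxc : 1 ≤ |x * c| := by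
      rw [abs_mul, abs_of_pos hc0]; exact one_le_mul_of_one_le_of_one_le hx hc1
    rw [hS, spike_of_one_le hX1 (by rwa [hy, Prod.mk.eta, k.symm_apply_apply, hXx])]
    simp only [hy, Prod.mk.eta, k.symm_apply_apply, hXx]
    rw [hψ1 _ hxc, hβ1 X hX1, hk, hX, Real.log_mul (mul_ne_zero hx0 hc0.ne') (Real.exp_pos _).ne',
      Real.log_exp, mul_assoc, mul_assoc, ← Circle.exp_add, ← Circle.exp_add]
    simp [hc0.ne']
  · rintro ⟨z, t, x⟩
    rw [hΘ]
    simp only [hS, spike]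
    have h1 : ∀ a b e : ℝ, (a * c * Real.exp b * Real.exp e * c⁻¹ ≤ 0 ↔ a ≤ 0) := by
      intro a b e
      rw [show a * c * Real.exp b * Real.exp e * c⁻¹ = a * (Real.exp b * Real.exp e) by
        field_simp]
      simpa using mul_le_mul_iff_left₀ (b := a) (c := 0) (mul_pos (Real.exp_pos b) (Real.exp_pos e))
    exact h1 _ _ _
  · intro z t
    rw [hΘ]
    simp only [hS, zero_mul]
    rw [spike_of_ge hs0 hε0 (by simpa using (k (z, t)).2.2.2)]
    simp [β, ψ]

/-- For an annulus homeomorphism `γ` preserving the bottom circle, the arc `γ ({1} × I)` can be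
straightened at level `0` by a homeomorphism of `Circle × I × ℝ` which is the identity outside
the levels of absolute value less than one, and which preserves the signs of levels. -/
lemma exists_homeo_straightening (γ : Circle × I ≃ₜ Circle × I)
    (hγ : ∀ p, (γ p).2 = 0 ↔ p.2 = 0) :
    ∃ Θ : Circle × I × ℝ ≃ₜ Circle × I × ℝ,
      (∀ q, 1 ≤ |q.2.2| → Θ q = q) ∧ (∀ q, (Θ q).2.2 ≤ 0 ↔ q.2.2 ≤ 0) ∧
      ∀ t, Θ ((γ (1, t)).1, (γ (1, t)).2, 0) = (1, t, 0) := by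
  have h1 : ∀ z, γ (z, 0) = ((γ (z, 0)).1, 0) := fun z => Prod.ext rfl ((hγ _).2 rfl)
  have h2 : ∀ z, γ.symm (z, 0) = ((γ.symm (z, 0)).1, 0) := fun z =>
    Prod.ext rfl ((hγ _).1 (by simp))
  let b : Circle ≃ₜ Circle :=
    { toFun := fun z => (γ (z, 0)).1
      invFun := fun z => (γ.symm (z, 0)).1
      left_inv := fun z => by simp [← h1]
      right_inv := fun z => by simp [← h2]
      continuous_toFun := by fun_prop
      continuous_invFun := by
        have := γ.symm.continuous
        fun_prop }
  have hb : ∀ z, b (γ.symm (z, 0)).1 = z := fun z => b.apply_symm_apply z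
  obtain ⟨Θ, hΘ1, hΘ2, hΘ3⟩ := exists_homeo_of_fix_bottom
    (γ.symm.trans (b.prodCongr (Homeomorph.refl I)))
    (fun z => by
      simp only [Homeomorph.trans_apply]
      rw [h2]
      simp [hb]) (-Complex.arg (b 1))
  refine ⟨Θ, hΘ1, hΘ2, fun t => ?_⟩
  rw [hΘ3]
  simp

/-- The point of the unit circle in the direction of a nonzero complex number. -/
noncomputable def direction (z : ℂ) : Circle := Circle.exp z.arg

lemma norm_mul_direction (z : ℂ) : (‖z‖ : ℂ) * direction z = z := by
  simp [direction, Circle.coe_exp]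

lemma direction_ofReal_mul {ρ : ℝ} (hρ : 0 < ρ) (z : Circle) : direction (ρ * z) = z := by
  rw [direction, Complex.arg_real_mul _ hρ, Circle.exp_arg]

lemma continuousAt_direction {z : ℂ} (hz : z ≠ 0) : ContinuousAt direction z := by
  have hi : IsInducing (fun w : Circle => (w : ℂ)) := ⟨rfl⟩
  rw [hi.continuousAt_iff]
  have h : ContinuousAt (fun w : ℂ => w / (‖w‖ : ℂ)) z :=
    continuousAt_id.div (by fun_prop) (by simpa using hz)
  refine h.congr ?_
  filter_upwards [isOpen_ne.mem_nhds hz] with w hw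
  have hw' : (‖w‖ : ℂ) ≠ 0 := by simpa using hw
  change _ = (direction w : ℂ)
  rw [div_eq_iff hw', mul_comm, norm_mul_direction]

/-- Cylindrical coordinates near the cylinder of radius `r`, with radial unit `δ`. -/
noncomputable def cyl (r δ : ℝ) (q : Circle × I × ℝ) : ℂ × I :=
  (((r + δ * q.2.2 : ℝ) : ℂ) * q.1, q.2.1)

/-- The inverse of `cyl` away from the axis. -/
noncomputable def uncyl (r δ : ℝ) (p : ℂ × I) : Circle × I × ℝ :=
  (direction p.1, p.2, (‖p.1‖ - r) / δ)

section Cyl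

variable {r δ : ℝ}

lemma cyl_uncyl (hδ : δ ≠ 0) (p : ℂ × I) : cyl r δ (uncyl r δ p) = p := by
  refine Prod.ext ?_ rfl
  simp only [cyl, uncyl]
  rw [mul_div_cancel₀ _ hδ, add_sub_cancel, norm_mul_direction]

lemma uncyl_cyl (hδ : δ ≠ 0) {q : Circle × I × ℝ} (hq : 0 < r + δ * q.2.2) :
    uncyl r δ (cyl r δ q) = q := by
  refine Prod.ext (direction_ofReal_mul hq q.1) (Prod.ext rfl ?_)
  simp only [cyl, uncyl, norm_mul, Complex.norm_real, Circle.norm_coe, Real.norm_eq_abs,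
    abs_of_pos hq]
  field_simp; ring

lemma continuous_cyl : Continuous (cyl r δ) := by
  unfold cyl; fun_prop

lemma continuousAt_uncyl {p : ℂ × I} (hp : p.1 ≠ 0) : ContinuousAt (uncyl r δ) p := by
  have := (continuousAt_direction hp).comp (continuousAt_fst (p := p))
  refine this.prodMk (ContinuousAt.prodMk ?_ ?_) <;> fun_prop

lemma cyl_comp_uncyl_eq_self (hδ : 0 < δ) {F : Circle × I × ℝ → Circle × I × ℝ}
    (hF : ∀ q, 1 ≤ |q.2.2| → F q = q) {p : ℂ × I} (hp : δ ≤ |‖p.1‖ - r|) :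
    cyl r δ (F (uncyl r δ p)) = p := by
  rw [hF, cyl_uncyl hδ.ne']
  rwa [uncyl, abs_div, abs_of_pos hδ, one_le_div hδ]

lemma continuous_cyl_comp_uncyl (hδ : 0 < δ) (hδr : δ < r)
    {F : Circle × I × ℝ → Circle × I × ℝ} (hFc : Continuous F)
    (hF : ∀ q, 1 ≤ |q.2.2| → F q = q) : Continuous fun p => cyl r δ (F (uncyl r δ p)) := by
  rw [continuous_iff_continuousAt]
  intro p
  by_cases hp : p.1 = 0
  · refine continuousAt_id.congr ?_
    have ho : IsOpen {p : ℂ × I | ‖p.1‖ < r - δ} := isOpen_lt (by fun_prop) (by fun_prop)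
    filter_upwards [ho.mem_nhds (by simpa [hp] using hδr)] with q hq
    refine (cyl_comp_uncyl_eq_self hδ hF ?_).symm
    rw [abs_sub_comm]
    have hq' : ‖q.1‖ < r - δ := hq
    exact le_trans (by simp only [id]; linarith) (le_abs_self _)
  · exact (continuous_cyl.comp hFc).continuousAt.comp (continuousAt_uncyl hp)

lemma cyl_comp_uncyl_leftInverse (hδ : 0 < δ) (hδr : δ < r)
    {F G : Circle × I × ℝ → Circle × I × ℝ} (hF : ∀ q, 1 ≤ |q.2.2| → F q = q)
    (hGF : ∀ q, G (F q) = q) (p : ℂ × I) :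
    cyl r δ (G (uncyl r δ (cyl r δ (F (uncyl r δ p))))) = p := by
  rcases le_or_gt δ |‖p.1‖ - r| with hp | hp
  · have hG : ∀ q, 1 ≤ |q.2.2| → G q = q := fun q hq => by
      conv_lhs => rw [← hF q hq, hGF]
    rw [cyl_comp_uncyl_eq_self hδ hF hp, cyl_comp_uncyl_eq_self hδ hG hp]
  · have hlt : |(F (uncyl r δ p)).2.2| < 1 := by
      by_contra! h
      have h1 : F (uncyl r δ p) = uncyl r δ p := by
        have := congrArg G (hF _ h)
        rwa [hGF, hGF] at this
      rw [h1, uncyl, abs_div, abs_of_pos hδ, one_le_div hδ] at h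
      linarith
    rw [uncyl_cyl hδ.ne', hGF, cyl_uncyl hδ.ne']
    nlinarith [(abs_lt.1 hlt).1]

end Cyl

lemma exists_homeo_cylinder {r₁ r : ℝ} (hr₁ : 0 < r₁) (hr₁r : r₁ < r) (hr : r < 1)
    (γ : Circle × I ≃ₜ Circle × I) (hγ : ∀ p, (γ p).2 = 0 ↔ p.2 = 0) :
    ∃ H : ℂ × I ≃ₜ ℂ × I,
      (∀ p, ‖p.1‖ ≤ r₁ → H p = p) ∧ (∀ p, 1 ≤ ‖p.1‖ → H p = p) ∧
      (∀ p, ‖(H p).1‖ ≤ r ↔ ‖p.1‖ ≤ r) ∧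
      ∀ t, H ((r : ℂ) * (γ (1, t)).1, (γ (1, t)).2) = ((r : ℂ), t) := by
  obtain ⟨Θ, hΘ, hΘ0, hΘγ⟩ := exists_homeo_straightening γ hγ
  have hΘ' : ∀ q, 1 ≤ |q.2.2| → Θ.symm q = q := fun q hq => by
    rw [Homeomorph.symm_apply_eq, hΘ q hq]
  obtain ⟨δ, hδ, hδ1, hδ2⟩ : ∃ δ, 0 < δ ∧ r₁ ≤ r - δ ∧ r + δ ≤ 1 :=
    ⟨min (r - r₁) (1 - r), lt_min (by linarith) (by linarith),
      by linarith [min_le_left (r - r₁) (1 - r)], by linarith [min_le_right (r - r₁) (1 - r)]⟩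
  have hδr : δ < r := by linarith
  let H : ℂ × I ≃ₜ ℂ × I :=
    { toFun := fun p => cyl r δ (Θ (uncyl r δ p))
      invFun := fun p => cyl r δ (Θ.symm (uncyl r δ p))
      left_inv := cyl_comp_uncyl_leftInverse hδ hδr hΘ Θ.symm_apply_apply
      right_inv := cyl_comp_uncyl_leftInverse hδ hδr hΘ' Θ.apply_symm_apply
      continuous_toFun := continuous_cyl_comp_uncyl hδ hδr Θ.continuous hΘ
      continuous_invFun := continuous_cyl_comp_uncyl hδ hδr Θ.symm.continuous hΘ' }
  have hH : ∀ p, H p = cyl r δ (Θ (uncyl r δ p)) := fun p => rfl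
  refine ⟨H, fun p hp => ?_, fun p hp => ?_, fun p => ?_, fun t => ?_⟩
  · refine cyl_comp_uncyl_eq_self hδ hΘ ?_
    rw [abs_sub_comm]
    exact le_trans (by linarith) (le_abs_self _)
  · exact cyl_comp_uncyl_eq_self hδ hΘ (le_trans (by linarith) (le_abs_self _))
  · have h1 : ‖p.1‖ ≤ r ↔ (uncyl r δ p).2.2 ≤ 0 := by
      rw [uncyl, div_le_iff₀ hδ, zero_mul, sub_nonpos]
    rw [h1, ← hΘ0, hH]
    simp only [cyl, norm_mul, Complex.norm_real, Circle.norm_coe, Real.norm_eq_abs, mul_one]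
    set s := (Θ (uncyl r δ p)).2.2 with hs
    by_cases h : 1 ≤ |(uncyl r δ p).2.2|
    · rw [hs, hΘ _ h]
      have : r + δ * (uncyl r δ p).2.2 = ‖p.1‖ := by simp only [uncyl]; field_simp; ring
      rw [this, abs_norm, h1]
    · have hlt : |s| < 1 := by
        by_contra! h'
        have := hΘ _ h'
        rw [Θ.injective.eq_iff] at this
        exact h (by rwa [hs, this] at h')
      rw [abs_of_pos (by nlinarith [(abs_lt.1 hlt).1])]
      constructor
      · intro h; nlinarith
      · intro h; nlinarith
  · have h1 : ((r : ℂ) * (γ (1, t)).1, (γ (1, t)).2) =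
        cyl r δ ((γ (1, t)).1, (γ (1, t)).2, 0) := by simp [cyl]
    rw [h1, hH, uncyl_cyl hδ.ne' (by simp; linarith), hΘγ]
    simp [cyl]

lemma isHomeoOn_of_inverse {X Y : Type*} [TopologicalSpace X] [TopologicalSpace Y]
    {f : X → Y} {f' : Y → X} {A : Set X} {B : Set Y} (hf : Continuous f) (hf' : Continuous f')
    (hA : ∀ a ∈ A, f a ∈ B) (hB : ∀ b ∈ B, f' b ∈ A) (hl : ∀ a ∈ A, f' (f a) = a)
    (hr : ∀ b ∈ B, f (f' b) = b) : IsHomeoOn f A B :=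
  ⟨{ toFun := fun a => ⟨f a, hA a a.2⟩
     invFun := fun b => ⟨f' b, hB b b.2⟩
     left_inv := fun a => Subtype.ext (hl a a.2)
     right_inv := fun b => Subtype.ext (hr b b.2)
     continuous_toFun := by fun_prop
     continuous_invFun := by fun_prop }, fun _ => rfl⟩

lemma exists_isometry_complex (x₀ : E2) : ∃ L : E2 ≃ₗᵢ[ℝ] ℂ, L x₀ = (‖x₀‖ : ℂ) := by
  let L₀ : E2 ≃ₗᵢ[ℝ] ℂ := Complex.orthonormalBasisOneI.repr.symm
  refine ⟨L₀.trans (rotation (direction (L₀ x₀))⁻¹), ?_⟩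
  rw [LinearIsometryEquiv.trans_apply, rotation_apply, Circle.coe_inv]
  have h := norm_mul_direction (L₀ x₀)
  rw [L₀.norm_map] at h
  generalize direction (L₀ x₀) = u at h ⊢
  rw [← h, mul_left_comm, inv_mul_cancel₀ (Circle.coe_ne_zero u), mul_one]

/-- A self-homeomorphism of `A` preserving `S ⊆ A` can be read through a homeomorphism `P` onto `S`
with inverse `U`. -/
lemma IsHomeoOn.exists_homeo_conj {X Z : Type*} [TopologicalSpace X] [TopologicalSpace Z]
    {g : X → X} {A S : Set X} {P : Z → X} {U : X → Z} (hg : IsHomeoOn g A A) (hSA : S ⊆ A)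
    (hgS : g '' S = S) (hPc : Continuous P) (hUc : ∀ p ∈ S, ContinuousAt U p)
    (hPS : ∀ p, P p ∈ S) (hUP : ∀ p, U (P p) = p) (hPU : ∀ p ∈ S, P (U p) = p) :
    ∃ γ : Z ≃ₜ Z, ∀ p, g (P p) = P (γ p) := by
  obtain ⟨e, he⟩ := hg
  have heS : ∀ a : A, (a : X) ∈ S → (e a : X) ∈ S := fun a ha => by
    rw [he, ← hgS]; exact mem_image_of_mem g ha
  have heS' : ∀ a : A, (a : X) ∈ S → (e.symm a : X) ∈ S := fun a ha => by
    rw [← hgS] at ha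
    obtain ⟨b, hb, hba⟩ := ha
    have : e ⟨b, hSA hb⟩ = a := Subtype.ext ((he _).trans hba)
    rw [← this, e.symm_apply_apply]
    exact hb
  let PA : Z → A := fun p => ⟨P p, hSA (hPS p)⟩
  have hPAc : Continuous PA := hPc.subtype_mk _
  have hPAU : ∀ a : A, (a : X) ∈ S → PA (U a) = a := fun a ha => Subtype.ext (hPU _ ha)
  have key : ∀ f : A → A, Continuous f → (∀ a : A, (a : X) ∈ S → (f a : X) ∈ S) →
      Continuous fun p => U (f (PA p)) := fun f hf hfS => by
    rw [continuous_iff_continuousAt]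
    intro p
    exact ContinuousAt.comp (f := fun p => (f (PA p) : X)) (hUc _ (hfS _ (hPS p)))
      (continuous_subtype_val.comp (hf.comp hPAc)).continuousAt
  let γ : Z ≃ₜ Z :=
    { toFun := fun p => U (e (PA p))
      invFun := fun p => U (e.symm (PA p))
      left_inv := fun p => by
        simp only []
        rw [hPAU _ (heS _ (hPS p)), e.symm_apply_apply]
        exact hUP p
      right_inv := fun p => by
        simp only []
        rw [hPAU _ (heS' _ (hPS p)), e.apply_symm_apply]
        exact hUP p
      continuous_toFun := key e e.continuous heS
      continuous_invFun := key e.symm e.symm.continuous heS' }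
  have hγ : ∀ p, g (P p) = P (γ p) := fun p => by
    rw [show γ p = U (e (PA p)) from rfl, hPU _ (heS _ (hPS p)), he]
  exact ⟨γ, hγ⟩

/-- A homeomorphism of a solid cylinder preserving the lateral boundary and the bottom restricts
to the lateral annulus, read in polar coordinates through the isometry `L`. -/
lemma exists_lateral_homeo {r : ℝ} (hr : 0 < r) (L : E2 ≃ₗᵢ[ℝ] ℂ) {g : E2 × ℝ → E2 × ℝ}
    (hg : IsHomeoOn g (closedBall (0 : E2) r ×ˢ Icc (0:ℝ) 1)
      (closedBall (0 : E2) r ×ˢ Icc (0:ℝ) 1))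
    (hgS : g '' (sphere (0 : E2) r ×ˢ Icc (0:ℝ) 1) = sphere (0 : E2) r ×ˢ Icc (0:ℝ) 1)
    (hgB : g '' (closedBall (0 : E2) r ×ˢ ({0} : Set ℝ)) =
      closedBall (0 : E2) r ×ˢ ({0} : Set ℝ)) :
    ∃ γ : Circle × I ≃ₜ Circle × I, (∀ p, (γ p).2 = 0 ↔ p.2 = 0) ∧
      ∀ p, g (L.symm (r * p.1), p.2) = (L.symm (r * (γ p).1), ((γ p).2 : ℝ)) := by
  let A : Set (E2 × ℝ) := closedBall (0 : E2) r ×ˢ Icc (0:ℝ) 1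
  let S : Set (E2 × ℝ) := sphere (0 : E2) r ×ˢ Icc (0:ℝ) 1
  let P : Circle × I → E2 × ℝ := fun p => (L.symm (r * p.1), p.2)
  let U : E2 × ℝ → Circle × I := fun p => (direction (L p.1), projIcc 0 1 (zero_le_one' ℝ) p.2)
  have hPc : Continuous P := by fun_prop
  have hPS : ∀ p, P p ∈ S := fun p => ⟨by
    rw [mem_sphere_zero_iff_norm, L.symm.norm_map, norm_mul, Complex.norm_real, Circle.norm_coe,
      Real.norm_eq_abs, abs_of_pos hr, mul_one], p.2.2⟩
  have hSA : S ⊆ A := prod_mono sphere_subset_closedBall subset_rfl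
  have hUP : ∀ p, U (P p) = p := fun p => by
    refine Prod.ext ?_ (projIcc_val (zero_le_one' ℝ) p.2)
    simp only [U, P, L.apply_symm_apply]
    exact direction_ofReal_mul hr _
  have hPU : ∀ p ∈ S, P (U p) = p := by
    rintro ⟨p, t⟩ ⟨hp, ht⟩
    have hp' : r = ‖L p‖ := by simpa using hp.symm
    refine Prod.ext ?_ ?_
    · simp only [P, U]
      rw [hp', norm_mul_direction, L.symm_apply_apply]
    · simp only [P, U]
      rw [projIcc_of_mem _ ht]
  have hUc : ∀ p ∈ S, ContinuousAt U p := by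
    rintro ⟨p, t⟩ ⟨hp, ht⟩
    have hp0 : L p ≠ 0 := by
      rw [← norm_ne_zero_iff, L.norm_map]
      have : ‖p‖ = r := by simpa using hp
      rw [this]; exact hr.ne'
    have h1 : ContinuousAt (fun q : E2 × ℝ => direction (L q.1)) (p, t) :=
      ContinuousAt.comp (f := fun q : E2 × ℝ => L q.1) (continuousAt_direction hp0) (by fun_prop)
    exact h1.prodMk (continuous_projIcc.continuousAt.comp continuousAt_snd)
  obtain ⟨γ, hγ⟩ := hg.exists_homeo_conj hSA hgS hPc hUc hPS hUP hPU
  refine ⟨γ, fun p => ?_, hγ⟩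
  have h2 : (g (P p)).2 = ((γ p).2 : ℝ) := by rw [hγ]
  constructor
  · intro h
    have hmem : g (P p) ∈ g '' (closedBall (0 : E2) r ×ˢ ({0} : Set ℝ)) := by
      rw [hgB]
      exact ⟨by rw [hγ]; exact (hSA (hPS (γ p))).1, by simp [h2, h]⟩
    obtain ⟨b, hb, hbp⟩ := hmem
    have hbA : b ∈ A := ⟨hb.1, by rw [mem_singleton_iff.1 hb.2]; simp⟩
    obtain ⟨e, he⟩ := hg
    have hbP : b = P p := congrArg Subtype.val (e.injective
      (Subtype.ext ((he ⟨b, hbA⟩).trans (hbp.trans (he ⟨P p, hSA (hPS p)⟩).symm))))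
    rw [hbP] at hb
    exact Subtype.ext (mem_singleton_iff.1 hb.2)
  · intro h
    have hmem : g (P p) ∈ closedBall (0 : E2) r ×ˢ ({0} : Set ℝ) := by
      rw [← hgB]
      exact mem_image_of_mem g ⟨(hSA (hPS p)).1, by simp [P, h]⟩
    exact Subtype.ext (h2.symm.trans (mem_singleton_iff.1 hmem.2))

end Straightening

/-- Given `0 < r₁ < r < 1`, a point `x₀` on the circle of radius `r`, and a
homeomorphism `g` of `B_r × [0,1]` onto itself preserving the core segment `{0} × [0,1]`, the
lateral boundary `∂B_r × [0,1]` and the bottom `B_r × {0}`, there is a homeomorphism `h` of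
`B₁ × [0,1]` onto itself which is the identity on `B_{r₁} × [0,1]` and on `∂B₁ × [0,1]`,
preserves `B_r × [0,1]`, and carries `g({x₀} × [0,1])` to `{x₀} × [0,1]`. -/
theorem stmt_0 (r₁ r : ℝ) (hr₁ : 0 < r₁) (hr₁r : r₁ < r) (hr : r < 1)
    (x₀ : E2) (hx₀ : ‖x₀‖ = r)
    (g : E2 × ℝ → E2 × ℝ)
    (hg : IsHomeoOn g (closedBall (0 : E2) r ×ˢ Icc (0:ℝ) 1)
      (closedBall (0 : E2) r ×ˢ Icc (0:ℝ) 1))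
    (hg0 : g '' (({0} : Set E2) ×ˢ Icc (0:ℝ) 1) = ({0} : Set E2) ×ˢ Icc (0:ℝ) 1)
    (hgS : g '' (sphere (0 : E2) r ×ˢ Icc (0:ℝ) 1) = sphere (0 : E2) r ×ˢ Icc (0:ℝ) 1)
    (hgB : g '' (closedBall (0 : E2) r ×ˢ ({0} : Set ℝ)) =
      closedBall (0 : E2) r ×ˢ ({0} : Set ℝ)) :
    ∃ h : E2 × ℝ → E2 × ℝ,
      IsHomeoOn h (closedBall (0 : E2) 1 ×ˢ Icc (0:ℝ) 1)
        (closedBall (0 : E2) 1 ×ˢ Icc (0:ℝ) 1) ∧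
      (∀ p ∈ closedBall (0 : E2) r₁ ×ˢ Icc (0:ℝ) 1, h p = p) ∧
      h '' (closedBall (0 : E2) r ×ˢ Icc (0:ℝ) 1) = closedBall (0 : E2) r ×ˢ Icc (0:ℝ) 1 ∧
      h '' (g '' (({x₀} : Set E2) ×ˢ Icc (0:ℝ) 1)) = ({x₀} : Set E2) ×ˢ Icc (0:ℝ) 1 ∧
      (∀ p ∈ sphere (0 : E2) 1 ×ˢ Icc (0:ℝ) 1, h p = p) := by
  have hr0 : 0 < r := hr₁.trans hr₁r
  obtain ⟨L, hL⟩ := exists_isometry_complex x₀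
  rw [hx₀] at hL
  have hL' : L.symm r = x₀ := by rw [← hL, L.symm_apply_apply]
  obtain ⟨γ, hγ, hgγ⟩ := exists_lateral_homeo hr0 L hg hgS hgB
  obtain ⟨H, hH1, hH2, hHr, hHγ⟩ := exists_homeo_cylinder hr₁ hr₁r hr γ hγ
  let T : (ℂ × unitInterval → ℂ × unitInterval) → E2 × ℝ → E2 × ℝ := fun F p =>
    (L.symm (F (L p.1, projIcc 0 1 zero_le_one p.2)).1,
      (F (L p.1, projIcc 0 1 zero_le_one p.2)).2)
  have hT : ∀ F (x : E2) (t : unitInterval), T F (x, t) =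
      (L.symm (F (L x, t)).1, ((F (L x, t)).2 : ℝ)) := fun F x t => by
    simp only [T, projIcc_val]
  have hTc : ∀ F, Continuous F → Continuous (T F) := fun F hF => by
    have := continuous_projIcc (h := zero_le_one' ℝ)
    fun_prop
  have hTid : ∀ F (x : E2) (t : ℝ), t ∈ Icc (0 : ℝ) 1 → (∀ s, F (L x, s) = (L x, s)) →
      T F (x, t) = (x, t) := fun F x t ht h => by
    lift t to unitInterval using ht
    rw [hT, h, L.symm_apply_apply]
  have hTinv : ∀ F G, (∀ q, G (F q) = q) → ∀ (x : E2) (t : ℝ), t ∈ Icc (0 : ℝ) 1 →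
      T G (T F (x, t)) = (x, t) := fun F G h x t ht => by
    lift t to unitInterval using ht
    rw [hT F x t, hT G, L.apply_symm_apply, Prod.mk.eta, h, L.symm_apply_apply]
  have hsymm : ∀ q, ‖(H.symm q).1‖ ≤ r ↔ ‖q.1‖ ≤ r := fun q => by
    rw [← hHr, H.apply_symm_apply]
  have hH2' : ∀ q, 1 ≤ ‖q.1‖ → H.symm q = q := fun q hq => by
    rw [Homeomorph.symm_apply_eq, hH2 q hq]
  have hball : ∀ F G : ℂ × unitInterval → ℂ × unitInterval, (∀ q, G (F q) = q) →
      (∀ q, 1 ≤ ‖q.1‖ → G q = q) → ∀ q, ‖q.1‖ ≤ 1 → ‖(F q).1‖ ≤ 1 := by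
    intro F G hGF hG q hq
    by_contra! h
    have := hG _ h.le
    rw [hGF] at this
    rw [← this] at h
    exact absurd hq (not_le.2 h)
  have hmaps : ∀ (F : ℂ × unitInterval → ℂ × unitInterval) (ρ : ℝ),
      (∀ q, ‖q.1‖ ≤ ρ → ‖(F q).1‖ ≤ ρ) → ∀ p ∈ closedBall (0 : E2) ρ ×ˢ Icc (0 : ℝ) 1,
        T F p ∈ closedBall (0 : E2) ρ ×ˢ Icc (0 : ℝ) 1 := by
    intro F ρ hF p hp
    refine ⟨?_, Subtype.prop _⟩
    rw [mem_closedBall_zero_iff, L.symm.norm_map]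
    exact hF _ (by simpa using hp.1)
  refine ⟨T H, isHomeoOn_of_inverse (f' := T H.symm) (hTc _ H.continuous)
    (hTc _ H.symm.continuous) (hmaps _ _ (hball _ _ H.symm_apply_apply hH2'))
    (hmaps _ _ (hball _ _ H.apply_symm_apply hH2))
    (fun p hp => hTinv _ _ H.symm_apply_apply _ _ hp.2)
    (fun p hp => hTinv _ _ H.apply_symm_apply _ _ hp.2), ?_, ?_, ?_, ?_⟩
  · rintro ⟨x, t⟩ ⟨hx, ht⟩
    exact hTid _ _ _ ht fun s => hH1 _ (by simpa using hx)
  · refine Subset.antisymm (image_subset_iff.2 (hmaps _ _ fun q => (hHr q).2)) fun p hp => ?_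
    exact ⟨T H.symm p, hmaps _ _ (fun q => (hsymm q).2) p hp,
      hTinv _ _ H.apply_symm_apply _ _ hp.2⟩
  · have key : ∀ t : unitInterval, T H (g (x₀, t)) = (x₀, (t : ℝ)) := fun t => by
      have h := hgγ (1, t)
      simp only [Circle.coe_one, mul_one, hL'] at h
      rw [h, hT, L.apply_symm_apply, hHγ, hL']
    rw [image_image]
    ext ⟨x, t⟩
    constructor
    · rintro ⟨⟨y, s⟩, ⟨hy, hs⟩, h⟩
      obtain rfl : y = x₀ := hy
      rw [← (key ⟨s, hs⟩).symm.trans h]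
      exact ⟨rfl, hs⟩
    · rintro ⟨hx, ht⟩
      obtain rfl : x = x₀ := hx
      exact ⟨(x, t), ⟨rfl, ht⟩, key ⟨t, ht⟩⟩
  · rintro ⟨x, t⟩ ⟨hx, ht⟩
    exact hTid _ _ _ ht fun s => hH2 _ (by simpa using hx.ge)
end

section
/- There exists a covering map from ℝ³ \ {0} onto S² × S¹, i.e., a continuous map p : ℝ³ \ {0} → S² × S¹ that is a covering map. -/
open Metric Set

/-- The 2-sphere, as the unit sphere of `ℝ³`. -/
abbrev S2 := Metric.sphere (0 : EuclideanSpace ℝ (Fin 3)) 1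

/-- The circle, as the unit sphere of `ℝ²`. -/
abbrev S1 := Metric.sphere (0 : EuclideanSpace ℝ (Fin 2)) 1

theorem IsEvenlyCovered.id_prodMap {A E X I : Type*} [TopologicalSpace A] [TopologicalSpace E]
    [TopologicalSpace X] [TopologicalSpace I] {f : E → X} {x : X}
    (h : IsEvenlyCovered f x I) (a : A) :
    IsEvenlyCovered (Prod.map id f : A × E → A × X) (a, x) I := by
  obtain ⟨inst, U, hxU, hU, hfU, H, hH⟩ := h
  refine ⟨inst, Prod.snd ⁻¹' U, hxU, hU.preimage continuous_snd, hfU.preimage continuous_snd,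
    { toFun e := (⟨(e.1.1, (H ⟨e.1.2, e.2⟩).1), (H ⟨e.1.2, e.2⟩).1.2⟩, (H ⟨e.1.2, e.2⟩).2)
      invFun y := ⟨(y.1.1.1, H.symm (⟨y.1.1.2, y.1.2⟩, y.2)),
        (H.symm (⟨y.1.1.2, y.1.2⟩, y.2)).2⟩
      left_inv _ := by simp
      right_inv _ := by simp
      continuous_toFun := by fun_prop
      continuous_invFun := by fun_prop }, fun e ↦ Prod.ext rfl (hH ⟨e.1.2, e.2⟩)⟩

theorem IsCoveringMap.id_prodMap {A E X : Type*} [TopologicalSpace A] [TopologicalSpace E]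
    [TopologicalSpace X] {f : E → X} (hf : IsCoveringMap f) :
    IsCoveringMap (Prod.map id f : A × E → A × X) :=
  fun y ↦ ((hf y.2).id_prodMap y.1).to_isEvenlyCovered_preimage

/-- The unit circle of `ℂ` is homeomorphic to the unit sphere of `ℝ²`. -/
noncomputable def Circle.homeomorphS1 : Circle ≃ₜ S1 :=
  Complex.orthonormalBasisOneI.repr.toHomeomorph.subtype fun z ↦ by
    simp [Submonoid.unitSphere]

/-- There is a covering map from `ℝ³ \ {0}` onto `S² × S¹`: a continuous
surjection which is a covering map. -/
theorem stmt_6 :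
    ∃ p : ({(0 : EuclideanSpace ℝ (Fin 3))}ᶜ : Set (EuclideanSpace ℝ (Fin 3))) → S2 × S1,
      Continuous p ∧ Function.Surjective p ∧ IsCoveringMap p := by
  let e : Ioi (0 : ℝ) ≃ₜ ℝ := Real.expOrderIso.symm.toHomeomorph
  let g := (homeomorphUnitSphereProd (EuclideanSpace ℝ (Fin 3))).trans
    ((Homeomorph.refl S2).prodCongr e)
  have hc : IsCoveringMap (Circle.homeomorphS1 ∘ Circle.exp) :=
    Circle.isCoveringMap_exp.homeomorph_comp _
  have hs : Function.Surjective (Circle.homeomorphS1 ∘ Circle.exp) :=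
    Circle.homeomorphS1.surjective.comp Circle.isAddQuotientCoveringMap_exp.surjective
  have hp := (hc.id_prodMap (A := S2)).comp_homeomorph g
  exact ⟨_, hp.continuous, (Function.surjective_id.prodMap hs).comp g.surjective, hp⟩
end

section
/- Let φ be a continuous flow of ℝ on a topological space X, and let Σ and Σ' be subsets of X. Assume: (i) there exists ε > 0 such that the map e : Σ × (−ε, ε) → X, e(x, s) = φ(s, x), is injective, is a homeomorphism onto its image, and has open image in X, and likewise there exists ε' > 0 with the analogous property for Σ'; (ii) every orbit {φ(t, x) : t ∈ ℝ} of φ meets Σ in exactly one point and meets Σ' in exactly one point. Then the map h : Σ → Σ' assigning to each x ∈ Σ the unique point of the orbit of x lying in Σ' is a homeomorphism from Σ onto Σ'; moreover, for every subset W ⊆ X that is invariant under the flow (φ(t, W) = W for all t ∈ ℝ), h maps Σ ∩ W onto Σ' ∩ W. -/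
open Set

/-- If every orbit meets `S` in exactly one point and `S` has a flow box, then the projection of
the space to `S` along the orbits is continuous. -/
theorem Flow.exists_continuous_orbit_projection {X : Type*} [TopologicalSpace X] (φ : Flow ℝ X)
    (S : Set X)
    (hS : ∃ ε > (0:ℝ), Topology.IsOpenEmbedding
      (fun p : S × Ioo (-ε) ε => φ (p.2 : ℝ) (p.1 : X)))
    (horb : ∀ x : X, ∃! y : X, y ∈ S ∧ ∃ t : ℝ, φ t x = y) :
    ∃ r : X → S, Continuous r ∧ (∀ x, ∃ t : ℝ, φ t x = r x) ∧
      ∀ x t, ∀ y : S, φ t x = y → r x = y := by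
  choose f hf huniq using horb
  obtain ⟨ε, hε, he⟩ := hS
  let r : X → S := fun x => ⟨f x, (hf x).1⟩
  have hr : ∀ x t, ∀ y : S, φ t x = y → r x = y := fun x t y h =>
    Subtype.ext (huniq x y ⟨y.2, t, h⟩).symm
  have hr_flow : ∀ t x, r (φ t x) = r x := by
    intro t x
    obtain ⟨s, hs⟩ := (hf (φ t x)).2
    exact (hr x (s + t) (r (φ t x)) (by rw [φ.map_add]; exact hs)).symm
  have hr_self : ∀ y : S, r y = y := fun y => hr y 0 y (φ.map_zero_apply _)
  refine ⟨r, continuous_iff_continuousAt.2 fun x => ?_, fun x => (hf x).2, hr⟩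
  obtain ⟨T, hT⟩ := (hf x).2
  have h_sec : ContinuousAt r (φ T x) := by
    have h := he.continuousAt_iff (g := r) (x := (r x, ⟨0, by simpa using hε⟩))
    simp only [φ.map_zero_apply] at h
    rw [hT]
    refine h.1 (Continuous.continuousAt ?_)
    convert continuous_fst using 1
    funext p
    exact (hr_flow _ _).trans (hr_self _)
  have h_comp : r = r ∘ φ T := funext fun z => (hr_flow T z).symm
  rw [h_comp]
  exact h_sec.comp (φ.continuous_toFun T).continuousAt

/-- Let `φ` be a continuous flow of `ℝ` on `X` and let `Sec`, `Sec'` be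
subsets of `X` such that, for some `ε > 0` (resp. `ε' > 0`), the map
`e : Sec × (−ε, ε) → X`, `e (x, s) = φ s x`, is injective, a homeomorphism onto its image
(an embedding), and has open image — and such that every orbit of `φ` meets `Sec` (resp.
`Sec'`) in exactly one point. Then the map sending each `x ∈ Sec` to the unique point of its
orbit lying in `Sec'` is a homeomorphism `Sec ≃ₜ Sec'`; moreover, for every flow-invariant
subset `W ⊆ X`, it maps `Sec ∩ W` onto `Sec' ∩ W`. -/
theorem stmt_7 {X : Type*} [TopologicalSpace X] (φ : Flow ℝ X) (Sec Sec' : Set X)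
    (hSec : ∃ ε > (0:ℝ),
      Function.Injective (fun p : Sec × Ioo (-ε) ε => φ (p.2 : ℝ) (p.1 : X)) ∧
      Topology.IsEmbedding (fun p : Sec × Ioo (-ε) ε => φ (p.2 : ℝ) (p.1 : X)) ∧
      IsOpen (Set.range fun p : Sec × Ioo (-ε) ε => φ (p.2 : ℝ) (p.1 : X)))
    (hSec' : ∃ ε' > (0:ℝ),
      Function.Injective (fun p : Sec' × Ioo (-ε') ε' => φ (p.2 : ℝ) (p.1 : X)) ∧
      Topology.IsEmbedding (fun p : Sec' × Ioo (-ε') ε' => φ (p.2 : ℝ) (p.1 : X)) ∧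
      IsOpen (Set.range fun p : Sec' × Ioo (-ε') ε' => φ (p.2 : ℝ) (p.1 : X)))
    (horb : ∀ x : X, ∃! y : X, y ∈ Sec ∧ ∃ t : ℝ, φ t x = y)
    (horb' : ∀ x : X, ∃! y : X, y ∈ Sec' ∧ ∃ t : ℝ, φ t x = y) :
    ∃ h : Sec ≃ₜ Sec',
      (∀ x : Sec, ∃ t : ℝ, φ t (x : X) = ((h x : Sec') : X)) ∧
      ∀ W : Set X, (∀ t : ℝ, (fun y => φ t y) '' W = W) →
        (fun y : Sec' => (y : X)) '' (h '' {x : Sec | (x : X) ∈ W}) = Sec' ∩ W := by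
  obtain ⟨ε, hε, -, he, ho⟩ := hSec
  obtain ⟨ε', hε', -, he', ho'⟩ := hSec'
  obtain ⟨r, hrc, hr, hru⟩ := φ.exists_continuous_orbit_projection Sec ⟨ε, hε, he, ho⟩ horb
  obtain ⟨r', hrc', hr', hru'⟩ :=
    φ.exists_continuous_orbit_projection Sec' ⟨ε', hε', he', ho'⟩ horb'
  have h_back : ∀ {t : ℝ} {x y : X}, φ t x = y → φ (-t) y = x := by
    rintro t x _ rfl
    rw [← φ.map_add, neg_add_cancel, φ.map_zero_apply]
  let h : Sec ≃ₜ Sec' :=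
    { toFun := fun x => r' x
      invFun := fun y => r y
      left_inv := fun x => by
        obtain ⟨t, ht⟩ := hr' x
        exact hru _ (-t) x (h_back ht)
      right_inv := fun y => by
        obtain ⟨t, ht⟩ := hr y
        exact hru' _ (-t) y (h_back ht)
      continuous_toFun := hrc'.comp continuous_subtype_val
      continuous_invFun := hrc.comp continuous_subtype_val }
  refine ⟨h, fun x => hr' x, fun W hW => ?_⟩
  have hWt : ∀ t, ∀ x ∈ W, φ t x ∈ W := fun t x hx => (hW t).subset (mem_image_of_mem _ hx)
  ext y
  constructor
  · rintro ⟨_, ⟨x, hx, rfl⟩, rfl⟩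
    obtain ⟨t, ht⟩ := hr' x
    exact ⟨(h x).2, show (r' x : X) ∈ W from ht ▸ hWt t x hx⟩
  · rintro ⟨hy, hyW⟩
    obtain ⟨t, ht⟩ := hr y
    have hrW : (r y : X) ∈ W := ht ▸ hWt t y hyW
    exact ⟨⟨y, hy⟩, ⟨h.symm ⟨y, hy⟩, hrW, h.apply_symm_apply _⟩, rfl⟩
end
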